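/- If t₀ ∈ (0,1) satisfies Y(t₀) = 1, then 0.48968967248 < A(t₀) < 0.48968967363. -/

import Mathlib

noncomputable def h1 (t : ℝ) : ℝ := (2*t+1)/((3*t+1)*(1-t))

noncomputable def h2 (t : ℝ) : ℝ :=
  -(t^2*(1-t)*(5*t^2+36*t+18))/(2*(t+3)*(2*t+1)*(3*t+1)^2)

noncomputable def Y (t : ℝ) : ℝ := -1 + h1 t * Real.exp (h2 t)

noncomputable def A (t : ℝ) : ℝ :=
  (3*t-1)*(t+1)^3*Real.log (t+1)/(16*t^3)
  + (3*t+1)*(1-t)^3*Real.log (2*t+1)/(32*t^3)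
  + (1-t)*(185*t^4+698*t^3-217*t^2-160*t+6)/(64*t*(3*t+1)^2*(t+3))

lemma log_ub (z x U : ℝ) (n : ℕ) (hx0 : 0 ≤ x) (hx1 : x < 1) (hz : 0 < z)
    (h : z * (1 - x) ≤ 1 + x)
    (hU : 2 * ((∑ i ∈ Finset.range n, x ^ (2 * i + 1) / (2 * i + 1))
      + x ^ (2 * n + 1) / (1 - x ^ 2)) ≤ U) : Real.log z ≤ U := by
  have h1 := Real.log_div_le_sum_range_add hx0 hx1 n
  have h2 : z ≤ (1 + x) / (1 - x) := by
    rw [le_div_iff₀ (by linarith)]; exact h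
  have h3 := Real.log_le_log hz h2
  linarith

lemma log_lb (z x L : ℝ) (n : ℕ) (hx0 : 0 ≤ x) (hx1 : x < 1)
    (h : 1 + x ≤ z * (1 - x))
    (hL : L ≤ 2 * ((∑ i ∈ Finset.range n, x ^ (2 * i + 1) / (2 * i + 1)))) :
    L ≤ Real.log z := by
  have h1 := Real.sum_range_le_log_div hx0 hx1 n
  have h2 : (1 + x) / (1 - x) ≤ z := by
    rw [div_le_iff₀ (by linarith)]; exact h
  have h3 := Real.log_le_log (div_pos (by linarith) (by linarith)) h2
  linarith

noncomputable def gg (t : ℝ) : ℝ :=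
  Real.log (2*t+1) - Real.log (3*t+1) - Real.log (1-t) + h2 t

lemma gg_deriv (t : ℝ) (h0 : 0 < t) (h1 : t < 1) : HasDerivAt gg
    (t^2*(864+4416*t+7536*t^2+4794*t^3+846*t^4+6*t^5-30*t^6)/
      (2*(1-t)*(2*t+1)^2*(3*t+1)^3*(t+3)^2)) t := by
  have hi := hasDerivAt_id' t
  have e1 : HasDerivAt (fun t : ℝ => 2*t+1) 2 t := by
    simpa using (hi.const_mul 2).add_const 1
  have e2 : HasDerivAt (fun t : ℝ => 3*t+1) 3 t := by
    simpa using (hi.const_mul 3).add_const 1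
  have e3 : HasDerivAt (fun t : ℝ => 1-t) (-1) t := by
    simpa using hi.const_sub 1
  have n1 : 2*t+1 ≠ 0 := by positivity
  have n2 : 3*t+1 ≠ 0 := by positivity
  have n3 : 1-t ≠ 0 := by linarith
  have n4 : t+3 ≠ 0 := by positivity
  have eP : HasDerivAt (fun t : ℝ => -(t^2*(1-t)*(5*t^2+36*t+18)))
      (-((2*t*(1-t) + t^2*(-1))*(5*t^2+36*t+18) + t^2*(1-t)*(10*t+36))) t := by
    have := ((((hasDerivAt_pow 2 t).mul e3).mul
      ((((hasDerivAt_pow 2 t).const_mul 5).add (hi.const_mul 36)).add_const 18))).neg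
    refine (this.congr_deriv ?_).congr_of_eventuallyEq (Filter.Eventually.of_forall fun s => ?_)
    · simp only [Pi.add_apply, Pi.mul_apply]; push_cast; ring
    · simp
  have eQ : HasDerivAt (fun t : ℝ => 2*(t+3)*(2*t+1)*(3*t+1)^2)
      ((2*(2*t+1) + 2*(t+3)*2)*(3*t+1)^2 + 2*(t+3)*(2*t+1)*(2*(3*t+1)*3)) t := by
    have := ((((hi.add_const 3).const_mul 2).mul e1).mul (e2.pow 2))
    refine (this.congr_deriv ?_).congr_of_eventuallyEq (Filter.Eventually.of_forall fun s => ?_)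
    · simp
    · simp
  have nQ : 2*(t+3)*(2*t+1)*(3*t+1)^2 ≠ 0 := by positivity
  have := (((e1.log n1).sub (e2.log n2)).sub (e3.log n3)).add (eP.div eQ nQ)
  refine HasDerivAt.congr_deriv (f := gg) this ?_
  field_simp
  ring

lemma gg_mono : StrictMonoOn gg (Set.Ioo 0 1) := by
  refine strictMonoOn_of_deriv_pos (convex_Ioo 0 1) ?_ ?_
  · intro t ht
    exact (gg_deriv t ht.1 ht.2).continuousAt.continuousWithinAt
  · intro t ht
    rw [interior_Ioo] at ht
    obtain ⟨h0, h1⟩ := ht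
    rw [(gg_deriv t h0 h1).deriv]
    have : 0 < 1 - t := by linarith
    have h6 : t^6 ≤ 1 := pow_le_one₀ h0.le h1.le
    have : 0 < 864+4416*t+7536*t^2+4794*t^3+846*t^4+6*t^5-30*t^6 := by
      have : 0 < 4416*t+7536*t^2+4794*t^3+846*t^4+6*t^5 := by positivity
      linarith
    positivity

lemma gg_eq (t : ℝ) (h0 : 0 < t) (h1' : t < 1) :
    gg t = Real.log (h1 t / 2) + Real.log 2 + h2 t := by
  have n3 : 1-t ≠ 0 := by linarith
  have n1 : 2*t+1 ≠ 0 := by positivity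
  have n2 : 3*t+1 ≠ 0 := by positivity
  have : h1 t ≠ 0 := by unfold h1; exact div_ne_zero n1 (mul_ne_zero n2 n3)
  rw [Real.log_div this (by norm_num)]
  unfold gg h1
  rw [Real.log_div n1 (mul_ne_zero n2 n3), Real.log_mul n2 n3]
  ring

lemma gg_a : gg 0.62637166330 < Real.log 2 := by
  rw [gg_eq _ (by norm_num) (by norm_num)]
  have h := log_ub (h1 0.62637166330 / 2) 0.023002104576573 0.0460123252903 6
    (by norm_num) (by norm_num) (by norm_num [h1]) (by norm_num [h1])
    (by norm_num [Finset.sum_range_succ])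
  have h' : h2 0.62637166330 < -0.0460123253 := by norm_num [h2]
  linarith

lemma gg_b : Real.log 2 < gg 0.62637166331 := by
  rw [gg_eq _ (by norm_num) (by norm_num)]
  have h := log_lb (h1 0.62637166331 / 2) 0.023002104589177 0.0460123253150 6
    (by norm_num) (by norm_num) (by norm_num [h1])
    (by norm_num [Finset.sum_range_succ])
  have h' : -0.046012325310 < h2 0.62637166331 := by norm_num [h2]
  linarith

lemma t_mem (t : ℝ) (h0 : 0 < t) (h1' : t < 1) (hY : Y t = 1) :
    0.62637166330 ≤ t ∧ t ≤ 0.62637166331 := by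
  have hg : gg t = Real.log 2 := by
    rw [gg_eq t h0 h1']
    have hpos : 0 < h1 t := by
      have : 0 < 1 - t := by linarith
      unfold h1; positivity
    have h : h1 t / 2 * Real.exp (h2 t) = 1 := by unfold Y at hY; linarith
    have := congrArg Real.log h
    rw [Real.log_mul (by positivity) (Real.exp_pos _).ne', Real.log_exp, Real.log_one] at this
    linarith
  have ha := gg_a
  have hb := gg_b
  constructor
  · by_contra! hc
    have := gg_mono ⟨h0, h1'⟩ ⟨by norm_num, by norm_num⟩ hc
    linarith
  · by_contra! hc
    have := gg_mono ⟨by norm_num, by norm_num⟩ ⟨h0, h1'⟩ hc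
    linarith

theorem A_at_t0 : ∀ t₀ : ℝ, t₀ ∈ Set.Ioo (0:ℝ) 1 → Y t₀ = 1 →
    0.48968967248 < A t₀ ∧ A t₀ < 0.48968967363 := by
  rintro t ⟨h0, h1'⟩ hY
  obtain ⟨ha, hb⟩ := t_mem t h0 h1' hY
  have l1 := log_lb (1+0.62637166330) 0.238493154663789 0.4863515602213 12
    (by norm_num) (by norm_num) (by norm_num) (by norm_num [Finset.sum_range_succ])
  have l2 := log_lb (2*0.62637166330+1) 0.385134392976975 0.8121487297934 17
    (by norm_num) (by norm_num) (by norm_num) (by norm_num [Finset.sum_range_succ])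
  have u1 := log_ub (1+0.62637166331) 0.238493154666689 0.4863515602279 12
    (by norm_num) (by norm_num) (by norm_num) (by norm_num) (by norm_num [Finset.sum_range_succ])
  have u2 := log_ub (2*0.62637166331+1) 0.385134392980757 0.8121487298028 17
    (by norm_num) (by norm_num) (by norm_num) (by norm_num) (by norm_num [Finset.sum_range_succ])
  have L1 : 0.4863515602213 ≤ Real.log (t+1) :=
    l1.trans (Real.log_le_log (by norm_num) (by linarith))
  have L2 : 0.8121487297934 ≤ Real.log (2*t+1) :=
    l2.trans (Real.log_le_log (by norm_num) (by linarith))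
  have U1 : Real.log (t+1) ≤ 0.4863515602279 :=
    le_trans (Real.log_le_log (by linarith) (by linarith)) u1
  have U2 : Real.log (2*t+1) ≤ 0.8121487298028 :=
    le_trans (Real.log_le_log (by linarith) (by linarith)) u2
  clear l1 l2 u1 u2 hY
  generalize hx : Real.log (t+1) = x at *
  generalize hy : Real.log (2*t+1) = y at *
  unfold A
  rw [hx, hy]
  clear hx hy
  have p1 : (0:ℝ) ≤ 3*t-1 := by linarith
  have p2 : (0:ℝ) ≤ 1-t := by linarith
  have p3 : (0:ℝ) ≤ x := by linarith
  have p4 : (0:ℝ) ≤ y := by linarith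
  have a2 : (0.62637166330:ℝ)^2 ≤ t^2 := by gcongr
  have a3 : (0.62637166330:ℝ)^3 ≤ t^3 := by gcongr
  have a4 : (0.62637166330:ℝ)^4 ≤ t^4 := by gcongr
  have b2 : t^2 ≤ (0.62637166331:ℝ)^2 := by gcongr
  have b3 : t^3 ≤ (0.62637166331:ℝ)^3 := by gcongr
  have b4 : t^4 ≤ (0.62637166331:ℝ)^4 := by gcongr
  generalize hp : 185*t^4+698*t^3-217*t^2-160*t+6 = p
  have pl : 185*0.62637166330^4+698*0.62637166330^3-217*0.62637166331^2-160*0.62637166331+6 ≤ p := by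
    linarith
  have pu : p ≤ 185*0.62637166331^4+698*0.62637166331^3-217*0.62637166330^2-160*0.62637166330+6 := by
    linarith
  clear a2 a3 a4 b2 b3 b4 hp
  have pp : 0 ≤ p := le_trans (by norm_num) pl
  have q1 : 3*t-1 ≤ 3*0.62637166331-1 := by linarith
  have q1' : 3*0.62637166330-1 ≤ 3*t-1 := by linarith
  have q2 : 1-t ≤ 1-0.62637166330 := by linarith
  have q2' : 1-0.62637166331 ≤ 1-t := by linarith
  constructor
  · calc
      (0.48968967248:ℝ) < (3*0.62637166330-1)*(0.62637166330+1)^3*0.4863515602213/(16*0.62637166331^3)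
        + (3*0.62637166330+1)*(1-0.62637166331)^3*0.8121487297934/(32*0.62637166331^3)
        + (1-0.62637166331)*(185*0.62637166330^4+698*0.62637166330^3-217*0.62637166331^2-160*0.62637166331+6)/(64*0.62637166331*(3*0.62637166331+1)^2*(0.62637166331+3)) := by
          norm_num
      _ ≤ _ := by
        refine add_le_add (add_le_add ?_ ?_) ?_
        · gcongr <;> norm_num
        · gcongr <;> norm_num
        · gcongr <;> norm_num
  · calc
      _ ≤ (3*0.62637166331-1)*(0.62637166331+1)^3*0.4863515602279/(16*0.62637166330^3)
        + (3*0.62637166331+1)*(1-0.62637166330)^3*0.8121487298028/(32*0.62637166330^3)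
        + (1-0.62637166330)*(185*0.62637166331^4+698*0.62637166331^3-217*0.62637166330^2-160*0.62637166330+6)/(64*0.62637166330*(3*0.62637166330+1)^2*(0.62637166330+3)) := by
          refine add_le_add (add_le_add ?_ ?_) ?_
          · gcongr <;> norm_num
          · gcongr <;> norm_num
          · gcongr <;> norm_num
      _ < (0.48968967363:ℝ) := by norm_num
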